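/- arXiv:0805.1045 — 3 statements merged into one kernel-verified Lean document; each statement's English description precedes it below -/
import Mathlib

section
/- Let G be a group, H a normal subgroup of G, and γ : H → ℝ any function. Suppose d is a bi-invariant metric on G that extends γ. Then for every φ ∈ G and every f ∈ H one has γ(f φ f⁻¹ φ⁻¹) ≤ 2 · d(φ, 1). In particular, for every φ ∈ G the set {γ(f φ f⁻¹ φ⁻¹) : f ∈ H} is bounded above, i.e. every element of G is bounded with respect to γ. -/
/-- The commutator `f φ f⁻¹ φ⁻¹` of an element `f` of a normal subgroup `H` with an
arbitrary element `φ` of the ambient group lies in `H`. -/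
def commMem {G : Type*} [Group G] {H : Subgroup G} (hN : H.Normal) (φ : G) (f : H) :
    (f : G) * φ * (f : G)⁻¹ * φ⁻¹ ∈ H := by
  have h1 : φ * (f : G)⁻¹ * φ⁻¹ ∈ H := hN.conj_mem _ (H.inv_mem f.2) φ
  have h2 := H.mul_mem f.2 h1
  simpa [mul_assoc] using h2

/-- The set `{γ(f φ f⁻¹ φ⁻¹) : f ∈ H}` of values of `γ` on commutators of elements of `H`
with a fixed `φ ∈ G`.  `φ` is bounded with respect to `γ` iff this set is bounded above. -/
def commSet {G : Type*} [Group G] {H : Subgroup G} (hN : H.Normal) (γ : H → ℝ) (φ : G) :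
    Set ℝ :=
  Set.range fun f : H => γ ⟨(f : G) * φ * (f : G)⁻¹ * φ⁻¹, commMem hN φ f⟩

/-- `d` is a bi-invariant metric on the group `G`. -/
def IsBiInvariantMetric {G : Type*} [Group G] (d : G → G → ℝ) : Prop :=
  (∀ g h, 0 ≤ d g h) ∧ (∀ g h, d g h = d h g) ∧ (∀ g h, d g h = 0 ↔ g = h) ∧
  (∀ g h k, d g k ≤ d g h + d h k) ∧
  (∀ g h k, d (k * g) (k * h) = d g h) ∧ (∀ g h k, d (g * k) (h * k) = d g h)

/-- If a bi-invariant metric `d` on `G` extends `γ : H → ℝ`, then every commutator value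
`γ(f φ f⁻¹ φ⁻¹)` is at most `2 * d φ 1`; in particular every element of `G` is bounded
with respect to `γ`. -/
theorem bounded_of_biinvariant_extension {G : Type*} [Group G] {H : Subgroup G}
    (hN : H.Normal) (γ : H → ℝ) (d : G → G → ℝ) (hd : IsBiInvariantMetric d)
    (hext : ∀ h : H, d (h : G) 1 = γ h) :
    (∀ (φ : G) (f : H),
      γ ⟨(f : G) * φ * (f : G)⁻¹ * φ⁻¹, commMem hN φ f⟩ ≤ 2 * d φ 1) ∧
    ∀ φ : G, BddAbove (commSet hN γ φ) := by
  obtain ⟨-, hsymm, -, htri, hl, hr⟩ := hd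
  have key : ∀ (φ : G) (f : H),
      γ ⟨(f : G) * φ * (f : G)⁻¹ * φ⁻¹, commMem hN φ f⟩ ≤ 2 * d φ 1 := by
    intro φ f
    rw [← hext]
    have hconj : d ((f : G) * φ * (f : G)⁻¹ * φ⁻¹) φ⁻¹ = d φ 1 := by
      calc d ((f : G) * φ * (f : G)⁻¹ * φ⁻¹) φ⁻¹
          = d ((f : G) * φ * (f : G)⁻¹) 1 := by
            simpa using hr ((f : G) * φ * (f : G)⁻¹) 1 φ⁻¹
        _ = d ((f : G) * φ) f := by
            simpa using (hr ((f : G) * φ * (f : G)⁻¹) 1 (f : G)).symm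
        _ = d φ 1 := by simpa using hl φ 1 (f : G)
    have hinv : d φ⁻¹ 1 = d φ 1 := by
      rw [hsymm φ 1]
      simpa using (hl φ⁻¹ 1 φ).symm
    calc d ((f : G) * φ * (f : G)⁻¹ * φ⁻¹) 1
        ≤ d ((f : G) * φ * (f : G)⁻¹ * φ⁻¹) φ⁻¹ + d φ⁻¹ 1 := htri _ _ _
      _ = 2 * d φ 1 := by rw [hconj, hinv, two_mul]
  refine ⟨key, fun φ => ⟨2 * d φ 1, ?_⟩⟩
  rintro _ ⟨f, rfl⟩
  exact key φ f
end

section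
/- Let G be a group, H a normal subgroup, and γ : H → ℝ a G-invariant norm on H. Suppose that H ≠ G and that every element φ ∈ G that is bounded with respect to γ belongs to H. Then there is no bi-invariant metric d on G with d(h, 1) = γ(h) for all h ∈ H. (This is the abstract form of the implication 'the bounded isometry conjecture for the spectral norm implies the nonextension conjecture for the spectral metric'.) -/
/-- `γ : H → ℝ` is a `G`-invariant norm on the normal subgroup `H`: nondegenerate,
symmetric, satisfies the triangle inequality, and invariant under conjugation by
arbitrary elements of `G`. -/
def IsInvariantNorm {G : Type*} [Group G] {H : Subgroup G} (hN : H.Normal) (γ : H → ℝ) : Prop :=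
  (∀ h : H, 0 ≤ γ h) ∧ (∀ h : H, γ h = 0 ↔ h = 1) ∧
  (∀ h : H, γ h⁻¹ = γ h) ∧ (∀ h₁ h₂ : H, γ (h₁ * h₂) ≤ γ h₁ + γ h₂) ∧
  (∀ (φ : G) (h : H), γ ⟨φ * (h : G) * φ⁻¹, hN.conj_mem _ h.2 φ⟩ = γ h)

/-- If `γ` is a `G`-invariant norm on the proper normal subgroup `H ≠ G` and every
element of `G` bounded with respect to `γ` lies in `H`, then no bi-invariant metric on
`G` extends `γ`. (The bounded isometry conjecture implies the nonextension conjecture.) -/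
theorem no_biinvariant_extension_of_bounded_isometry {G : Type*} [Group G] {H : Subgroup G}
    (hN : H.Normal) (γ : H → ℝ) (hγ : IsInvariantNorm hN γ) (hne : H ≠ ⊤)
    (hbd : ∀ φ : G, BddAbove (commSet hN γ φ) → φ ∈ H) :
    ¬ ∃ d : G → G → ℝ, IsBiInvariantMetric d ∧ ∀ h : H, d (h : G) 1 = γ h := by
  rintro ⟨d, ⟨-, -, -, htri, hleft, hright⟩, hext⟩
  refine hne (H.eq_top_iff'.2 fun φ => hbd φ ⟨d φ 1 + d φ⁻¹ 1, ?_⟩)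
  rintro _ ⟨f, rfl⟩
  have hconj : d ((f : G) * φ * (f : G)⁻¹) 1 = d φ 1 := by
    have h := hright ((f : G) * φ) ((f : G) * 1) (f : G)⁻¹
    rwa [hleft, mul_one, mul_inv_cancel] at h
  have hshift := hright ((f : G) * φ * (f : G)⁻¹) 1 φ⁻¹
  rw [one_mul, hconj] at hshift
  simp only [← hext, ← hshift]
  exact htri _ _ _
end

section
/- Let m ≥ 1, let A be an invertible skew-symmetric real m × m matrix (Aᵀ = −A), let W : ℝ → ℝ be any function, and set v = A⁻¹ e₁ ∈ ℝᵐ, where e₁ is the first standard basis vector. Suppose x : ℝ → ℝᵐ is differentiable and satisfies the ODE x'(t) = W(x(t)₁) · v for all t ∈ ℝ, where x(t)₁ denotes the first coordinate of x(t). Then the first coordinate t ↦ x(t)₁ is constant, and x(t) = x(0) + t · W(x(0)₁) · v for all t. Moreover, if x(1) = x(0), then W(x(0)₁) = 0 and x is constant. -/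
open Matrix

/-- The inverse of a skew-symmetric real matrix has zero diagonal. -/
theorem inv_apply_self_of_transpose_eq_neg {n : Type*} [Fintype n] [DecidableEq n]
    {A : Matrix n n ℝ} (hA : Aᵀ = -A) (hA' : IsUnit A) (i : n) : A⁻¹ i i = 0 := by
  have hdet : IsUnit A.det := (Matrix.isUnit_iff_isUnit_det A).mp hA'
  have hinv : (-A)⁻¹ = -A⁻¹ :=
    Matrix.inv_eq_left_inv (by rw [neg_mul_neg, Matrix.nonsing_inv_mul A hdet])
  have h : A⁻¹ᵀ = -A⁻¹ := by rw [Matrix.transpose_nonsing_inv, hA, hinv]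
  have hii : A⁻¹ i i = -A⁻¹ i i := congrFun (congrFun h i) i
  linarith

/-- A curve with constant derivative is affine. -/
theorem eq_add_smul_of_hasDerivAt_const {E : Type*} [NormedAddCommGroup E] [NormedSpace ℝ E]
    {f : ℝ → E} {w : E} (hf : ∀ t, HasDerivAt f w t) (t : ℝ) : f t = f 0 + t • w := by
  have hg : ∀ s, HasDerivAt (fun s => f s - s • w) 0 s := fun s => by
    simpa using (hf s).fun_sub ((hasDerivAt_id s).smul_const w)
  have h := is_const_of_deriv_eq_zero (fun s => (hg s).differentiableAt)
    (fun s => (hg s).deriv) t 0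
  simpa [sub_eq_iff_eq_add] using h

/-- Let `A` be an invertible skew-symmetric real `m × m` matrix, `W : ℝ → ℝ` any
function, and `v = A⁻¹ e₁`.  If `x : ℝ → ℝᵐ` solves the ODE `x' t = W (x t 0) • v`,
then the first coordinate of `x` is constant, `x t = x 0 + (t * W (x 0 0)) • v`,
and if moreover `x 1 = x 0` then `W (x 0 0) = 0` and `x` is constant.  (For a
Hamiltonian depending only on the first coordinate on a linear symplectic torus,
the only contractible 1-periodic orbits are the critical points.) -/
theorem periodic_orbits_are_constant {m : ℕ} (hm : 1 ≤ m)
    (A : Matrix (Fin m) (Fin m) ℝ) (hA : Aᵀ = -A) (hA' : IsUnit A)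
    (W : ℝ → ℝ) (x : ℝ → Fin m → ℝ)
    (hx : ∀ t : ℝ, HasDerivAt x
      (W (x t ⟨0, hm⟩) • A⁻¹.mulVec (Pi.single (⟨0, hm⟩ : Fin m) 1)) t) :
    (∀ t : ℝ, x t ⟨0, hm⟩ = x 0 ⟨0, hm⟩) ∧
    (∀ t : ℝ, x t = x 0 +
      (t * W (x 0 ⟨0, hm⟩)) • A⁻¹.mulVec (Pi.single (⟨0, hm⟩ : Fin m) 1)) ∧
    (x 1 = x 0 → W (x 0 ⟨0, hm⟩) = 0 ∧ ∀ t : ℝ, x t = x 0) := by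
  have hdet : IsUnit A.det := (Matrix.isUnit_iff_isUnit_det A).mp hA'
  have hv0 : A⁻¹.mulVec (Pi.single (⟨0, hm⟩ : Fin m) 1) ⟨0, hm⟩ = 0 := by
    simpa using inv_apply_self_of_transpose_eq_neg hA hA' ⟨0, hm⟩
  have hv : A⁻¹.mulVec (Pi.single (⟨0, hm⟩ : Fin m) 1) ≠ 0 := fun h => by
    have h' := congrArg A.mulVec h
    rw [Matrix.mulVec_mulVec, Matrix.mul_nonsing_inv A hdet, Matrix.one_mulVec,
      Matrix.mulVec_zero] at h'
    simpa using congrFun h' ⟨0, hm⟩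
  generalize A⁻¹.mulVec (Pi.single (⟨0, hm⟩ : Fin m) 1) = v at hx hv0 hv ⊢
  have hfirst : ∀ t : ℝ, x t ⟨0, hm⟩ = x 0 ⟨0, hm⟩ := fun t => by
    have hd : ∀ s, HasDerivAt (fun s => x s ⟨0, hm⟩) 0 s := fun s => by
      simpa [hv0] using hasDerivAt_pi.mp (hx s) ⟨0, hm⟩
    simpa using eq_add_smul_of_hasDerivAt_const hd t
  have hsol : ∀ t : ℝ, x t = x 0 + (t * W (x 0 ⟨0, hm⟩)) • v := fun t => by
    have hd : ∀ s, HasDerivAt x (W (x 0 ⟨0, hm⟩) • v) s := fun s => hfirst s ▸ hx s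
    rw [mul_smul]
    exact eq_add_smul_of_hasDerivAt_const hd t
  refine ⟨hfirst, hsol, fun h => ?_⟩
  have hW : W (x 0 ⟨0, hm⟩) = 0 := by
    have h1 := hsol 1
    rw [h, one_mul, left_eq_add] at h1
    exact (smul_eq_zero.mp h1).resolve_right hv
  exact ⟨hW, fun t => by simpa [hW] using hsol t⟩
end
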